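/- arXiv:2602.15054 — 16 statements merged into one kernel-verified Lean document; each statement's English description precedes it below -/
import Mathlib

section
/- Let a, b, c be the side lengths of a non-degenerate triangle (a, b, c > 0 with a + b > c, b + c > a, a + c > b), and let m_a = (1/2)√(2b² + 2c² − a²), m_b = (1/2)√(2a² + 2c² − b²), m_c = (1/2)√(2a² + 2b² − c²) be the lengths of the corresponding medians. Then √(bc)·m_a + √(ac)·m_b + √(ab)·m_c ≥ a·m_a + b·m_b + c·m_c. -/
theorem median_weight_poly_nonneg {x y z : ℝ} (hx : 0 < x) (hy : 0 < y) (hz : 0 < z)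
    (hxy : y ≤ x) (h : z ^ 2 ≤ x ^ 2 + y ^ 2) :
    0 ≤ (x + y) * (x ^ 4 + 3 * x ^ 2 * y ^ 2 + y ^ 4)
      + 2 * z * (x ^ 4 + 3 * x ^ 3 * y + 3 * x ^ 2 * y ^ 2 + 3 * x * y ^ 3 + y ^ 4)
      + 3 * z ^ 2 * (x + y) * (x ^ 2 + y ^ 2) - 2 * z ^ 4 * (2 * z + x + y) := by
  have h4 : z ^ 4 ≤ (x ^ 2 + y ^ 2) ^ 2 := by
    calc z ^ 4 = (z ^ 2) ^ 2 := by ring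
      _ ≤ _ := by gcongr
  have h5 : 0 ≤ 4 * z * ((x ^ 2 + y ^ 2) ^ 2 - z ^ 4) :=
    mul_nonneg (by positivity) (sub_nonneg.2 h4)
  have h6 : 0 ≤ 2 * z ^ 2 * (x + y) * (x ^ 2 + y ^ 2 - z ^ 2) :=
    mul_nonneg (by positivity) (sub_nonneg.2 h)
  have h7 : 0 ≤ (x + y) * (x ^ 2 + y ^ 2) * (x - z) ^ 2 := by positivity
  have h8 : 0 ≤ 2 * z * (y ^ 3 * (x - y)) :=
    mul_nonneg (by positivity) (mul_nonneg (by positivity) (sub_nonneg.2 hxy))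
  have h9 : 0 ≤ 2 * z * (4 * x ^ 3 * y + 3 * x * y ^ 3) := by positivity
  have h10 : 0 ≤ (x + y) * (2 * x ^ 2 * y ^ 2 + y ^ 4) := by positivity
  nlinarith

theorem add_mul_sqrt_le_add_mul_sqrt {x y z : ℝ} (hx : 0 < x) (hy : 0 < y) (hz : 0 < z)
    (hxy : y ≤ x) (h : z ^ 2 ≤ x ^ 2 + y ^ 2) :
    (z + x) * √(2 * y ^ 4 + 2 * z ^ 4 - x ^ 4) ≤ (z + y) * √(2 * x ^ 4 + 2 * z ^ 4 - y ^ 4) := by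
  have key := mul_nonneg (sub_nonneg.2 hxy) (median_weight_poly_nonneg hx hy hz hxy h)
  rw [← Real.sqrt_sq (by positivity : 0 ≤ z + x), ← Real.sqrt_sq (by positivity : 0 ≤ z + y),
    ← Real.sqrt_mul (sq_nonneg _), ← Real.sqrt_mul (sq_nonneg _)]
  apply Real.sqrt_le_sqrt
  linarith

theorem sub_mul_sub_sqrt_nonneg {x y z : ℝ} (hx : 0 < x) (hy : 0 < y) (hz : 0 < z)
    (h : z ^ 2 ≤ x ^ 2 + y ^ 2) :
    0 ≤ (x - y) * ((z + y) * √(2 * x ^ 4 + 2 * z ^ 4 - y ^ 4)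
      - (z + x) * √(2 * y ^ 4 + 2 * z ^ 4 - x ^ 4)) := by
  rcases le_total y x with hxy | hxy
  · exact mul_nonneg (sub_nonneg.2 hxy)
      (sub_nonneg.2 (add_mul_sqrt_le_add_mul_sqrt hx hy hz hxy h))
  · exact mul_nonneg_of_nonpos_of_nonpos (sub_nonpos.2 hxy)
      (sub_nonpos.2 (add_mul_sqrt_le_add_mul_sqrt hy hx hz hxy (by linarith)))

theorem stmt_0 (a b c ma mb mc : ℝ)
    (ha : 0 < a) (hb : 0 < b) (hc : 0 < c)
    (hab : a + b > c) (hbc : b + c > a) (hac : a + c > b)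
    (hma : ma = Real.sqrt (2*b^2 + 2*c^2 - a^2) / 2)
    (hmb : mb = Real.sqrt (2*a^2 + 2*c^2 - b^2) / 2)
    (hmc : mc = Real.sqrt (2*a^2 + 2*b^2 - c^2) / 2) :
    Real.sqrt (b*c) * ma + Real.sqrt (a*c) * mb + Real.sqrt (a*b) * mc
      ≥ a * ma + b * mb + c * mc := by
  obtain ⟨x, hx, rfl⟩ : ∃ x, 0 < x ∧ x ^ 2 = a := ⟨√a, Real.sqrt_pos.2 ha, Real.sq_sqrt ha.le⟩
  obtain ⟨y, hy, rfl⟩ : ∃ y, 0 < y ∧ y ^ 2 = b := ⟨√b, Real.sqrt_pos.2 hb, Real.sq_sqrt hb.le⟩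
  obtain ⟨z, hz, rfl⟩ : ∃ z, 0 < z ∧ z ^ 2 = c := ⟨√c, Real.sqrt_pos.2 hc, Real.sq_sqrt hc.le⟩
  have sqrt_sq_mul_sq {u v : ℝ} (hu : 0 < u) (hv : 0 < v) : √(u ^ 2 * v ^ 2) = u * v := by
    rw [← mul_pow, Real.sqrt_sq (mul_pos hu hv).le]
  have hxy := sub_mul_sub_sqrt_nonneg hx hy hz hab.le
  have hyz := sub_mul_sub_sqrt_nonneg hy hz hx hbc.le
  have hxz := sub_mul_sub_sqrt_nonneg hx hz hy hac.le
  rw [add_comm (2 * y ^ 4) (2 * x ^ 4), add_comm (2 * z ^ 4) (2 * x ^ 4)] at hyz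
  rw [add_comm (2 * z ^ 4) (2 * y ^ 4)] at hxz
  simp only [← pow_mul, Nat.reduceMul] at hma hmb hmc
  rw [sqrt_sq_mul_sq hy hz, sqrt_sq_mul_sq hx hz, sqrt_sq_mul_sq hx hy, hma, hmb, hmc]
  linarith
end

section
/- Let a, b, c be the side lengths of a non-degenerate triangle with a = b (isosceles triangle), and let m_a, m_b, m_c be the medians to the respective sides. Then √(bc)·m_a + √(ac)·m_b + √(ab)·m_c ≥ a·m_a + b·m_b + c·m_c. -/
theorem stmt_1 (a b c ma mb mc : ℝ)
    (ha : 0 < a) (hb : 0 < b) (hc : 0 < c)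
    (heq : a = b) (hab : a + b > c) (hbc : b + c > a) (hac : a + c > b)
    (hma : ma = Real.sqrt (2*b^2 + 2*c^2 - a^2) / 2)
    (hmb : mb = Real.sqrt (2*a^2 + 2*c^2 - b^2) / 2)
    (hmc : mc = Real.sqrt (2*a^2 + 2*b^2 - c^2) / 2) :
    Real.sqrt (b*c) * ma + Real.sqrt (a*c) * mb + Real.sqrt (a*b) * mc
      ≥ a * ma + b * mb + c * mc := by
  subst heq
  obtain rfl : ma = mb := hma.trans hmb.symm
  have hma0 : 0 ≤ ma := by rw [hma]; positivity
  have hmc0 : 0 ≤ mc := by rw [hmc]; positivity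
  have hma2 : 4 * ma ^ 2 = a ^ 2 + 2 * c ^ 2 := by
    rw [hma, div_pow, Real.sq_sqrt (by nlinarith)]; ring
  have hmc2 : 4 * mc ^ 2 = 4 * a ^ 2 - c ^ 2 := by
    rw [hmc, div_pow, Real.sq_sqrt (by nlinarith)]; ring
  clear hma hmb hmc
  rw [Real.sqrt_mul_self ha.le, Real.sqrt_mul ha.le]
  obtain ⟨p, hp, rfl⟩ : ∃ p : ℝ, 0 < p ∧ a = p ^ 2 :=
    ⟨√a, Real.sqrt_pos.2 ha, (Real.sq_sqrt ha.le).symm⟩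
  obtain ⟨q, hq, rfl⟩ : ∃ q : ℝ, 0 < q ∧ c = q ^ 2 :=
    ⟨√c, Real.sqrt_pos.2 hc, (Real.sq_sqrt hc.le).symm⟩
  rw [Real.sqrt_sq hp.le, Real.sqrt_sq hq.le]
  have hdiff : 4 * ((2 * p * ma) ^ 2 - ((p + q) * mc) ^ 2) =
      (q - p) * (q * (q ^ 4 + 3 * q ^ 3 * p + 12 * q ^ 2 * p ^ 2 + 12 * q * p ^ 3 + 8 * p ^ 4)) := by
    linear_combination 4 * p ^ 2 * hma2 - (p + q) ^ 2 * hmc2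
  have hpos : 0 < q * (q ^ 4 + 3 * q ^ 3 * p + 12 * q ^ 2 * p ^ 2 + 12 * q * p ^ 3 + 8 * p ^ 4) := by
    positivity
  suffices h : 0 ≤ (q - p) * (2 * p * ma - (p + q) * mc) by linarith
  rcases le_total p q with hpq | hpq
  · have hle : (p + q) * mc ≤ 2 * p * ma :=
      le_of_sq_le_sq (by linarith [mul_nonneg (sub_nonneg.2 hpq) hpos.le]) (by positivity)
    exact mul_nonneg (sub_nonneg.2 hpq) (sub_nonneg.2 hle)
  · have hle : 2 * p * ma ≤ (p + q) * mc :=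
      le_of_sq_le_sq (by linarith [mul_nonpos_of_nonpos_of_nonneg (sub_nonpos.2 hpq) hpos.le])
        (by positivity)
    exact mul_nonneg_of_nonpos_of_nonpos (sub_nonpos.2 hpq) (sub_nonpos.2 hle)
end

section
/- Let a, b, c be the side lengths of a non-degenerate triangle with b = c, and let m_a, m_b, m_c be the medians to the respective sides. Then √(bc)·m_a + √(ac)·m_b + √(ab)·m_c ≥ a·m_a + b·m_b + c·m_c. -/
theorem stmt_2 (a b c ma mb mc : ℝ)
    (ha : 0 < a) (hb : 0 < b) (hc : 0 < c)
    (heq : b = c) (hab : a + b > c) (hbc : b + c > a) (hac : a + c > b)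
    (hma : ma = Real.sqrt (2*b^2 + 2*c^2 - a^2) / 2)
    (hmb : mb = Real.sqrt (2*a^2 + 2*c^2 - b^2) / 2)
    (hmc : mc = Real.sqrt (2*a^2 + 2*b^2 - c^2) / 2) :
    Real.sqrt (b*c) * ma + Real.sqrt (a*c) * mb + Real.sqrt (a*b) * mc
      ≥ a * ma + b * mb + c * mc := by
  subst heq
  have hmbc : mc = mb := by rw [hmb, hmc]
  have hma0 : 0 ≤ ma := by rw [hma]; positivity
  have hma2 : ma ^ 2 = (4 * b ^ 2 - a ^ 2) / 4 := by
    rw [hma, div_pow, Real.sq_sqrt (by nlinarith)]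
    ring
  have hmb0 : 0 < mb := by
    rw [hmb]
    exact half_pos (Real.sqrt_pos.2 (by nlinarith [sq_pos_of_pos ha, sq_pos_of_pos hb]))
  have hmb2 : mb ^ 2 = (2 * a ^ 2 + b ^ 2) / 4 := by
    rw [hmb, div_pow, Real.sq_sqrt (by nlinarith [sq_pos_of_pos ha, sq_pos_of_pos hb])]
    ring
  rw [hmbc, Real.sqrt_mul_self hb.le, Real.sqrt_mul ha.le]
  obtain ⟨x, hx, rfl⟩ : ∃ x : ℝ, 0 < x ∧ x ^ 2 = a :=
    ⟨√a, Real.sqrt_pos.2 ha, Real.sq_sqrt ha.le⟩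
  obtain ⟨y, hy, rfl⟩ : ∃ y : ℝ, 0 < y ∧ y ^ 2 = b :=
    ⟨√b, Real.sqrt_pos.2 hb, Real.sq_sqrt hb.le⟩
  rw [Real.sqrt_sq hx.le, Real.sqrt_sq hy.le]
  have hsum : 0 < (x + y) * ma + 2 * y * mb := by positivity
  have hprod : (y - x) * ((x + y) * ma - 2 * y * mb) * ((x + y) * ma + 2 * y * mb) =
      (y - x) ^ 2 * (x * (x ^ 4 + 3 * x ^ 3 * y + 12 * x ^ 2 * y ^ 2 + 12 * x * y ^ 3
        + 8 * y ^ 4)) / 4 := by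
    linear_combination (y - x) * (x + y) ^ 2 * hma2 - (y - x) * (2 * y) ^ 2 * hmb2
  have hdiff : 0 ≤ (y - x) * ((x + y) * ma - 2 * y * mb) :=
    nonneg_of_mul_nonneg_left (by rw [hprod]; positivity) hsum
  linarith
end

section
/- Let a, b, c be the side lengths of a non-degenerate triangle, and let m_a, m_b, m_c be the medians to the respective sides. Then (bc − a²)·m_a + (ac − b²)·m_b + (ab − c²)·m_c ≥ 0. -/
theorem median_radicand_pos {a b c : ℝ} (hb : 0 < b) (h : b < a + c) :
    0 < 2*a^2 + 2*c^2 - b^2 := by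
  nlinarith [sq_nonneg (a - c)]

theorem sub_mul_sub_median_nonneg {a b c x y : ℝ} (ha : 0 < a) (hb : 0 < b) (hc : 0 < c)
    (hab : c < a + b) (hx : 0 < x) (hy : 0 < y)
    (hx2 : 4 * x^2 = 2*b^2 + 2*c^2 - a^2) (hy2 : 4 * y^2 = 2*a^2 + 2*c^2 - b^2) :
    0 ≤ (a - b) * ((b + c) * y - (a + c) * x) := by
  have hpos : 0 < 4 * ((b + c) * y + (a + c) * x) := by positivity
  have hsub : 0 < a + b - c := by linarith
  have key : (a - b) * ((b + c) * y - (a + c) * x) * (4 * ((b + c) * y + (a + c) * x)) =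
      (a - b)^2 * ((a + b - c) * (4*c^2 + 3*(a + b)*c + a^2 + b^2)) := by
    linear_combination (a - b) * (b + c)^2 * hy2 - (a - b) * (a + c)^2 * hx2
  refine nonneg_of_mul_nonneg_left ?_ hpos
  rw [key]
  positivity

theorem four_mul_sq_half_sqrt {r : ℝ} (hr : 0 ≤ r) : 4 * (Real.sqrt r / 2)^2 = r := by
  linear_combination Real.sq_sqrt hr

theorem stmt_3 (a b c ma mb mc : ℝ)
    (ha : 0 < a) (hb : 0 < b) (hc : 0 < c)
    (hab : a + b > c) (hbc : b + c > a) (hac : a + c > b)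
    (hma : ma = Real.sqrt (2*b^2 + 2*c^2 - a^2) / 2)
    (hmb : mb = Real.sqrt (2*a^2 + 2*c^2 - b^2) / 2)
    (hmc : mc = Real.sqrt (2*a^2 + 2*b^2 - c^2) / 2) :
    (b*c - a^2) * ma + (a*c - b^2) * mb + (a*b - c^2) * mc ≥ 0 := by
  have ra : 0 < 2*b^2 + 2*c^2 - a^2 := median_radicand_pos ha (by linarith)
  have rb : 0 < 2*a^2 + 2*c^2 - b^2 := median_radicand_pos hb (by linarith)
  have rc : 0 < 2*a^2 + 2*b^2 - c^2 := median_radicand_pos hc (by linarith)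
  have pa : 0 < ma := hma ▸ half_pos (Real.sqrt_pos.2 ra)
  have pb : 0 < mb := hmb ▸ half_pos (Real.sqrt_pos.2 rb)
  have pc : 0 < mc := hmc ▸ half_pos (Real.sqrt_pos.2 rc)
  have qa : 4 * ma^2 = 2*b^2 + 2*c^2 - a^2 := hma ▸ four_mul_sq_half_sqrt ra.le
  have qb : 4 * mb^2 = 2*a^2 + 2*c^2 - b^2 := hmb ▸ four_mul_sq_half_sqrt rb.le
  have qc : 4 * mc^2 = 2*a^2 + 2*b^2 - c^2 := hmc ▸ four_mul_sq_half_sqrt rc.le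
  have h₁ := sub_mul_sub_median_nonneg ha hb hc hab pa pb qa qb
  have h₂ := sub_mul_sub_median_nonneg hb hc ha hbc pb pc (by linarith) (by linarith)
  have h₃ := sub_mul_sub_median_nonneg ha hc hb hac pa pc (by linarith) (by linarith)
  linarith
end

section
/- Let a, b, c be the side lengths of a non-degenerate triangle, and let m_a, m_b, m_c be the medians to the respective sides. Then 2a·m_a ≤ c·m_b + b·m_c, 2b·m_b ≤ a·m_c + c·m_a, and 2c·m_c ≤ a·m_b + b·m_a. -/
/-- For a triangle with sides `a, b, c`, the doubled medians `x, y, z` satisfy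
`2 a x ≤ c y + b z`. After squaring twice, the difference of the two sides is
`16 S ^ 2 * (2 * a ^ 2 - b ^ 2 - c ^ 2) ^ 2`, where `S` is the area. -/
lemma two_mul_side_mul_median_le {a b c : ℝ} (ha : 0 < a) (hb : 0 < b) (hc : 0 < c)
    (hab : c < a + b) (hbc : a < b + c) (hac : b < a + c) :
    2 * a * √(2 * b ^ 2 + 2 * c ^ 2 - a ^ 2) ≤
      c * √(2 * a ^ 2 + 2 * c ^ 2 - b ^ 2) + b * √(2 * a ^ 2 + 2 * b ^ 2 - c ^ 2) := by
  have hx : 0 ≤ 2 * b ^ 2 + 2 * c ^ 2 - a ^ 2 := by nlinarith [sq_nonneg (b - c)]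
  have hy : 0 ≤ 2 * a ^ 2 + 2 * c ^ 2 - b ^ 2 := by nlinarith [sq_nonneg (a - c)]
  have hz : 0 ≤ 2 * a ^ 2 + 2 * b ^ 2 - c ^ 2 := by nlinarith [sq_nonneg (a - b)]
  have hx2 := Real.sq_sqrt hx
  have hy2 := Real.sq_sqrt hy
  have hz2 := Real.sq_sqrt hz
  have hy0 := Real.sqrt_nonneg (2 * a ^ 2 + 2 * c ^ 2 - b ^ 2)
  have hz0 := Real.sqrt_nonneg (2 * a ^ 2 + 2 * b ^ 2 - c ^ 2)
  generalize √(2 * b ^ 2 + 2 * c ^ 2 - a ^ 2) = x at *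
  generalize √(2 * a ^ 2 + 2 * c ^ 2 - b ^ 2) = y at *
  generalize √(2 * a ^ 2 + 2 * b ^ 2 - c ^ 2) = z at *
  have heron : 0 ≤ (a + b + c) * (a + b - c) * (b + c - a) * (a + c - b) :=
    mul_nonneg (mul_nonneg (mul_nonneg (by linarith) (by linarith)) (by linarith)) (by linarith)
  have key : 3 * a ^ 2 * (b ^ 2 + c ^ 2) - 2 * a ^ 4 - b ^ 4 - c ^ 4 + b ^ 2 * c ^ 2 ≤
      b * c * (y * z) := by
    refine le_of_sq_le_sq ?_ (by positivity)
    have h : (b * c * (y * z)) ^ 2 = b ^ 2 * c ^ 2 *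
        ((2 * a ^ 2 + 2 * c ^ 2 - b ^ 2) * (2 * a ^ 2 + 2 * b ^ 2 - c ^ 2)) := by
      rw [← hy2, ← hz2]; ring
    rw [h]
    linear_combination mul_nonneg heron (sq_nonneg (2 * a ^ 2 - b ^ 2 - c ^ 2))
  refine le_of_sq_le_sq ?_ (by positivity)
  linear_combination 2 * key + 4 * a ^ 2 * hx2 - c ^ 2 * hy2 - b ^ 2 * hz2

theorem stmt_4 (a b c ma mb mc : ℝ)
    (ha : 0 < a) (hb : 0 < b) (hc : 0 < c)
    (hab : a + b > c) (hbc : b + c > a) (hac : a + c > b)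
    (hma : ma = Real.sqrt (2*b^2 + 2*c^2 - a^2) / 2)
    (hmb : mb = Real.sqrt (2*a^2 + 2*c^2 - b^2) / 2)
    (hmc : mc = Real.sqrt (2*a^2 + 2*b^2 - c^2) / 2) :
    2*a*ma ≤ c*mb + b*mc ∧ 2*b*mb ≤ a*mc + c*ma ∧ 2*c*mc ≤ a*mb + b*ma := by
  have h₁ := two_mul_side_mul_median_le ha hb hc hab hbc hac
  have h₂ := two_mul_side_mul_median_le hb hc ha hbc (by linarith) (by linarith)
  have h₃ := two_mul_side_mul_median_le hc ha hb (by linarith) hab (by linarith)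
  rw [add_comm (2 * c ^ 2) (2 * a ^ 2), add_comm (2 * b ^ 2) (2 * a ^ 2)] at h₂
  rw [add_comm (2 * c ^ 2) (2 * b ^ 2), add_comm (2 * c ^ 2) (2 * a ^ 2)] at h₃
  subst hma hmb hmc
  refine ⟨?_, ?_, ?_⟩ <;> linarith
end

section
/- Let a, b, c be the side lengths of a non-degenerate triangle with a < b < c, and let m_a, m_b, m_c be the medians to the respective sides. Then √(bc)·m_a + √(ac)·m_b ≥ b·m_b + c·m_c. -/
/-- The product of two medians of a triangle, each doubled, is at most `2 * c ^ 2 + a * b`. -/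
lemma sqrt_median_mul_sqrt_median_le {a b c : ℝ} (ha : 0 < a) (hb : 0 < b) (hc : 0 < c)
    (hab : c < a + b) (hac : b < a + c) :
    Real.sqrt (2*b^2 + 2*c^2 - a^2) * Real.sqrt (2*a^2 + 2*c^2 - b^2) ≤ 2*c^2 + a*b := by
  have hY : 0 ≤ 2*a^2 + 2*c^2 - b^2 := by nlinarith [sq_nonneg (a - c)]
  rw [← Real.sqrt_mul' _ hY]
  apply Real.sqrt_le_iff.2 ⟨by positivity, ?_⟩
  have h : 0 ≤ (a - b)^2 * ((a + b)^2 - c^2) :=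
    mul_nonneg (sq_nonneg _) (by nlinarith)
  linear_combination 2 * h

/-- The inequality between doubled medians with `√(bc)` and `√(ac)` replaced by `b` and `a`. -/
lemma mul_sqrt_median_add_mul_sqrt_median_le {a b c : ℝ} (ha : 0 < a) (hab : c < a + b)
    (h1 : a < b) (h2 : b < c) :
    b * Real.sqrt (2*a^2 + 2*c^2 - b^2) + c * Real.sqrt (2*a^2 + 2*b^2 - c^2) ≤
      b * Real.sqrt (2*b^2 + 2*c^2 - a^2) + a * Real.sqrt (2*a^2 + 2*c^2 - b^2) := by
  have hb : 0 < b := ha.trans h1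
  have hc : 0 < c := hb.trans h2
  have hxy := sqrt_median_mul_sqrt_median_le ha hb hc hab (by linarith)
  have hle : Real.sqrt (2*a^2 + 2*c^2 - b^2) ≤ Real.sqrt (2*b^2 + 2*c^2 - a^2) :=
    Real.sqrt_le_sqrt (by nlinarith)
  have hX := Real.sq_sqrt (show 0 ≤ 2*b^2 + 2*c^2 - a^2 by nlinarith)
  have hY := Real.sq_sqrt (show 0 ≤ 2*a^2 + 2*c^2 - b^2 by nlinarith)
  have hZ := Real.sq_sqrt (show 0 ≤ 2*a^2 + 2*b^2 - c^2 by nlinarith [sq_nonneg (a - b)])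
  have hY0 := Real.sqrt_nonneg (2*a^2 + 2*c^2 - b^2)
  generalize Real.sqrt (2*b^2 + 2*c^2 - a^2) = x at *
  generalize Real.sqrt (2*a^2 + 2*c^2 - b^2) = y at *
  generalize Real.sqrt (2*a^2 + 2*b^2 - c^2) = z at *
  have hnonneg : 0 ≤ b * x - (b - a) * y := by nlinarith
  have hsq : (c * z)^2 ≤ (b * x - (b - a) * y)^2 := by
    have h := mul_le_mul_of_nonneg_left hxy (mul_pos hb (sub_pos.2 h1)).le
    have hF : 0 ≤ (c^2 - b^2)^2 + 2 * (a * (a - b))^2 := by positivity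
    linear_combination 2 * h + hF + c^2 * hZ - b^2 * hX - (b - a)^2 * hY
  linarith [le_abs_self (c * z), abs_le_of_sq_le_sq hsq hnonneg]

theorem stmt_6 (a b c ma mb mc : ℝ)
    (ha : 0 < a) (hb : 0 < b) (hc : 0 < c)
    (hab : a + b > c) (hbc : b + c > a) (hac : a + c > b)
    (h1 : a < b) (h2 : b < c)
    (hma : ma = Real.sqrt (2*b^2 + 2*c^2 - a^2) / 2)
    (hmb : mb = Real.sqrt (2*a^2 + 2*c^2 - b^2) / 2)
    (hmc : mc = Real.sqrt (2*a^2 + 2*b^2 - c^2) / 2) :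
    Real.sqrt (b*c) * ma + Real.sqrt (a*c) * mb ≥ b * mb + c * mc := by
  have key := mul_sqrt_median_add_mul_sqrt_median_le ha hab h1 h2
  have hma0 : 0 ≤ ma := by rw [hma]; positivity
  have hmb0 : 0 ≤ mb := by rw [hmb]; positivity
  have hbc' : b ≤ Real.sqrt (b*c) := Real.le_sqrt_of_sq_le (by nlinarith)
  have hac' : a ≤ Real.sqrt (a*c) := Real.le_sqrt_of_sq_le (by nlinarith)
  have hx := mul_le_mul_of_nonneg_right hbc' hma0
  have hy := mul_le_mul_of_nonneg_right hac' hmb0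
  have hlin : b * mb + c * mc ≤ b * ma + a * mb := by
    rw [hma, hmb, hmc]
    linarith
  linarith
end

section
/- Let a, b, c be the side lengths of a non-degenerate triangle with a < b < c, and let m_a, m_b, m_c be the medians to the respective sides. Then b·m_b > max(a·m_a, c·m_c). -/
lemma mul_sqrt_lt_mul_sqrt {x y u v : ℝ} (hx : 0 ≤ x) (hy : 0 ≤ y) (hu : 0 ≤ u)
    (h : x ^ 2 * u < y ^ 2 * v) : x * √u < y * √v := by
  rw [← Real.sqrt_sq hx, ← Real.sqrt_sq hy, ← Real.sqrt_mul (sq_nonneg x),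
    ← Real.sqrt_mul (sq_nonneg y)]
  exact Real.sqrt_lt_sqrt (by positivity) h

theorem stmt_7 (a b c ma mb mc : ℝ)
    (ha : 0 < a) (hb : 0 < b) (hc : 0 < c)
    (hab : a + b > c) (hbc : b + c > a) (hac : a + c > b)
    (h1 : a < b) (h2 : b < c)
    (hma : ma = Real.sqrt (2*b^2 + 2*c^2 - a^2) / 2)
    (hmb : mb = Real.sqrt (2*a^2 + 2*c^2 - b^2) / 2)
    (hmc : mc = Real.sqrt (2*a^2 + 2*b^2 - c^2) / 2) :
    b * mb > max (a * ma) (c * mc) := by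
  have hab2 : 0 < b ^ 2 - a ^ 2 := by nlinarith
  have hbc2 : 0 < c ^ 2 - b ^ 2 := by nlinarith
  have hA : a * √(2*b^2 + 2*c^2 - a^2) < b * √(2*a^2 + 2*c^2 - b^2) := by
    apply mul_sqrt_lt_mul_sqrt ha.le hb.le (by nlinarith)
    have h : 0 < (b ^ 2 - a ^ 2) * (2 * c ^ 2 - a ^ 2 - b ^ 2) := mul_pos hab2 (by linarith)
    linarith
  have hC : c * √(2*a^2 + 2*b^2 - c^2) < b * √(2*a^2 + 2*c^2 - b^2) := by
    apply mul_sqrt_lt_mul_sqrt hc.le hb.le (by nlinarith [sq_nonneg (a - b)])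
    have h : 0 < (c ^ 2 - b ^ 2) * (c ^ 2 + b ^ 2 - 2 * a ^ 2) := mul_pos hbc2 (by linarith)
    linarith
  subst hma hmb hmc
  exact max_lt (by linarith) (by linarith)
end

section
/- Let x, y be real numbers with 0 < x ≤ y ≤ 1 and x + y > 1. Then √y·√(2 + 2y² − x²) + √x·√(2 + 2x² − y²) + √(xy)·√(2x² + 2y² − 1) ≥ x·√(2 + 2y² − x²) + y·√(2 + 2x² − y²) + √(2x² + 2y² − 1). -/
/-- In a triangle with sides `a²`, `b²`, `c²`, the median to the smaller of the sides `a²`, `b²`,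
weighted by `c` plus the square root of that side, is the larger of the two weighted medians. -/
lemma weighted_median_le {a b c : ℝ} (ha : 0 < a) (hab : a ≤ b) (hc : 0 < c)
    (h : c ^ 2 ≤ a ^ 2 + b ^ 2) :
    (c + b) * Real.sqrt (2 * a ^ 4 + 2 * c ^ 4 - b ^ 4) ≤
      (c + a) * Real.sqrt (2 * b ^ 4 + 2 * c ^ 4 - a ^ 4) := by
  have hb : 0 < b := ha.trans_le hab
  have hcs : c ≤ a + b := by nlinarith [mul_pos ha hb]
  have hs : c ^ 4 ≤ (a ^ 2 + b ^ 2) ^ 2 := by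
    calc c ^ 4 = (c ^ 2) ^ 2 := by ring
      _ ≤ (a ^ 2 + b ^ 2) ^ 2 := by gcongr
  have h₁ : c * c ^ 4 ≤ c * (a ^ 2 + b ^ 2) ^ 2 := by gcongr
  have h₂ : c * c ^ 4 ≤ (a + b) * (a ^ 2 + b ^ 2) ^ 2 := by gcongr
  have h₃ : c ^ 2 * (a + b) * c ^ 2 ≤ c ^ 2 * (a + b) * (a ^ 2 + b ^ 2) := by gcongr
  have h₄ : c ^ 4 * c ≤ c ^ 4 * (a + b) := by gcongr
  have h₅ : 0 ≤ 2 * c * (3 * (a * b) * (a ^ 2 + b ^ 2) + a ^ 2 * b ^ 2)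
      + (a + b) * (a ^ 2 * b ^ 2) := by positivity
  have hQ : 0 ≤ 2 * c * (a ^ 4 + 3 * a ^ 3 * b + 3 * a ^ 2 * b ^ 2 + 3 * a * b ^ 3 + b ^ 4)
      + (a + b) * (a ^ 4 + 3 * a ^ 2 * b ^ 2 + b ^ 4) + 3 * c ^ 2 * (a + b) * (a ^ 2 + b ^ 2)
      - 4 * c ^ 5 - 2 * c ^ 4 * (a + b) := by
    linarith
  have hP := mul_nonneg (sub_nonneg.2 hab) hQ
  have hsqrt (u v : ℝ) (hu : 0 ≤ u) : u * Real.sqrt v = Real.sqrt (u ^ 2 * v) := by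
    rw [Real.sqrt_mul (sq_nonneg u), Real.sqrt_sq hu]
  rw [hsqrt _ _ (by positivity), hsqrt _ _ (by positivity)]
  exact Real.sqrt_le_sqrt (by linarith)

theorem stmt_9 (x y : ℝ) (hx : 0 < x) (hxy : x ≤ y) (hy : y ≤ 1) (hsum : x + y > 1) :
    Real.sqrt y * Real.sqrt (2 + 2*y^2 - x^2) + Real.sqrt x * Real.sqrt (2 + 2*x^2 - y^2)
      + Real.sqrt (x*y) * Real.sqrt (2*x^2 + 2*y^2 - 1)
    ≥ x * Real.sqrt (2 + 2*y^2 - x^2) + y * Real.sqrt (2 + 2*x^2 - y^2)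
      + Real.sqrt (2*x^2 + 2*y^2 - 1) := by
  have hy0 : 0 < y := hx.trans_le hxy
  rw [Real.sqrt_mul hx.le]
  have ha : 0 < Real.sqrt x := Real.sqrt_pos.2 hx
  have hab : Real.sqrt x ≤ Real.sqrt y := Real.sqrt_le_sqrt hxy
  have hb1 : Real.sqrt y ≤ 1 := Real.sqrt_le_one.2 hy
  have hxa : x = Real.sqrt x ^ 2 := (Real.sq_sqrt hx.le).symm
  have hyb : y = Real.sqrt y ^ 2 := (Real.sq_sqrt hy0.le).symm
  generalize Real.sqrt x = a at *
  generalize Real.sqrt y = b at *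
  subst hxa hyb
  have hb : 0 < b := ha.trans_le hab
  have h₁ := weighted_median_le ha hab one_pos (by linarith)
  have h₂ := weighted_median_le ha (hab.trans hb1) hb (by nlinarith)
  have h₃ := weighted_median_le hb hb1 ha (by nlinarith)
  rw [show 2 * a ^ 4 + 2 * 1 ^ 4 - b ^ 4 = 2 + 2 * (a ^ 2) ^ 2 - (b ^ 2) ^ 2 by ring,
    show 2 * b ^ 4 + 2 * 1 ^ 4 - a ^ 4 = 2 + 2 * (b ^ 2) ^ 2 - (a ^ 2) ^ 2 by ring] at h₁
  rw [show 2 * a ^ 4 + 2 * b ^ 4 - 1 ^ 4 = 2 * (a ^ 2) ^ 2 + 2 * (b ^ 2) ^ 2 - 1 by ring,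
    show 2 * 1 ^ 4 + 2 * b ^ 4 - a ^ 4 = 2 + 2 * (b ^ 2) ^ 2 - (a ^ 2) ^ 2 by ring] at h₂
  rw [show 2 * b ^ 4 + 2 * a ^ 4 - 1 ^ 4 = 2 * (a ^ 2) ^ 2 + 2 * (b ^ 2) ^ 2 - 1 by ring,
    show 2 * 1 ^ 4 + 2 * a ^ 4 - b ^ 4 = 2 + 2 * (a ^ 2) ^ 2 - (b ^ 2) ^ 2 by ring] at h₃
  linarith [mul_nonneg (sub_nonneg.2 hab) (sub_nonneg.2 h₁),
    mul_nonneg (sub_nonneg.2 (hab.trans hb1)) (sub_nonneg.2 h₂),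
    mul_nonneg (sub_nonneg.2 hb1) (sub_nonneg.2 h₃)]
end

section
/- Let a, b, c be the side lengths of a non-degenerate triangle, and let h_a = 2S/a, h_b = 2S/b, h_c = 2S/c be the altitudes, where S is the area of the triangle given by Heron's formula. Then (bc − a²)·h_a + (ac − b²)·h_b + (ab − c²)·h_c ≥ 0. -/
theorem stmt_11 (a b c s S ha' hb' hc' : ℝ)
    (ha : 0 < a) (hb : 0 < b) (hc : 0 < c)
    (hab : a + b > c) (hbc : b + c > a) (hac : a + c > b)
    (hs : s = (a + b + c) / 2)
    (hS : S = Real.sqrt (s * (s - a) * (s - b) * (s - c)))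
    (hha : ha' = 2 * S / a) (hhb : hb' = 2 * S / b) (hhc : hc' = 2 * S / c) :
    (b*c - a^2) * ha' + (a*c - b^2) * hb' + (a*b - c^2) * hc' ≥ 0 := by
  have hS0 : 0 ≤ S := hS ▸ Real.sqrt_nonneg _
  have key : (b*c - a^2) * ha' + (a*c - b^2) * hb' + (a*b - c^2) * hc' =
      S / (a * b * c) * ((a*b - b*c)^2 + (b*c - a*c)^2 + (a*c - a*b)^2) := by
    rw [hha, hhb, hhc]
    field_simp
    ring
  rw [key]
  positivity
end

section
/- Let a, b, c be the side lengths of a non-degenerate triangle with a ≤ b ≤ c, and let l_a, l_b, l_c be the internal angle bisectors, where l_a = (2/(b + c))·√(b·c·s·(s − a)) with s = (a + b + c)/2, and similarly for l_b and l_c. Then b·l_b ≥ max(a·l_a, c·l_c). -/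
/-- Comparing two sides scaled by their bisectors amounts to a polynomial inequality. -/
theorem side_mul_bisector_le {x y z s : ℝ} (hx : 0 < x) (hy : 0 < y) (hz : 0 < z)
    (hs : s = (x + y + z) / 2) (hyz : x < y + z) (hxz : y < x + z)
    (h : x * (y + z - x) * (x + z) ^ 2 ≤ y * (x + z - y) * (y + z) ^ 2) :
    x * (2 / (y + z) * √(y * z * s * (s - x))) ≤ y * (2 / (x + z) * √(x * z * s * (s - y))) := by
  have hs0 : 0 < s := by linarith
  have hsx : 0 < s - x := by linarith
  have hsy : 0 < s - y := by linarith
  have key : x * (s - x) / (y + z) ^ 2 ≤ y * (s - y) / (x + z) ^ 2 := by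
    rw [div_le_div_iff₀ (by positivity) (by positivity), hs]
    linarith
  apply le_of_sq_le_sq _ (by positivity)
  rw [mul_pow, mul_pow, mul_pow, mul_pow, Real.sq_sqrt (by positivity),
    Real.sq_sqrt (by positivity)]
  calc x ^ 2 * ((2 / (y + z)) ^ 2 * (y * z * s * (s - x)))
      = 4 * x * y * z * s * (x * (s - x) / (y + z) ^ 2) := by field_simp; norm_num
    _ ≤ 4 * x * y * z * s * (y * (s - y) / (x + z) ^ 2) := by gcongr
    _ = y ^ 2 * ((2 / (x + z)) ^ 2 * (x * z * s * (s - y))) := by field_simp; norm_num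

theorem shortest_middle_poly_le {a b c : ℝ} (ha : 0 < a) (hab : a ≤ b) (hbc : b ≤ c) :
    a * (b + c - a) * (a + c) ^ 2 ≤ b * (a + c - b) * (b + c) ^ 2 := by
  have key : 0 ≤ b * (a + c - b) * (a + b + 2 * c) - (a + c) ^ 2 * (a + b - c) := by
    obtain ⟨y, rfl⟩ : ∃ y, b = a + y := ⟨b - a, by ring⟩
    obtain ⟨z, rfl⟩ : ∃ z, c = a + y + z := ⟨c - (a + y), by ring⟩
    have hy : 0 ≤ y := by linarith
    have hz : 0 ≤ z := by linarith
    ring_nf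
    positivity
  linarith [mul_nonneg (sub_nonneg.2 hab) key]

theorem longest_middle_poly_le {a b c : ℝ} (ha : 0 < a) (hab : a ≤ b) (hbc : b ≤ c) :
    c * (b + a - c) * (c + a) ^ 2 ≤ b * (c + a - b) * (b + a) ^ 2 := by
  have key : 0 ≤ (c + b - a) * (a + b) ^ 2 - c * (a + b - c) * (2 * a + b + c) := by
    obtain ⟨y, rfl⟩ : ∃ y, b = a + y := ⟨b - a, by ring⟩
    obtain ⟨z, rfl⟩ : ∃ z, c = a + y + z := ⟨c - (a + y), by ring⟩
    have hy : 0 ≤ y := by linarith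
    have hz : 0 ≤ z := by linarith
    ring_nf
    positivity
  linarith [mul_nonneg (sub_nonneg.2 hbc) key]

theorem stmt_13 (a b c s la lb lc : ℝ)
    (ha : 0 < a) (hb : 0 < b) (hc : 0 < c)
    (hab : a + b > c) (hbc : b + c > a) (hac : a + c > b)
    (h1 : a ≤ b) (h2 : b ≤ c)
    (hs : s = (a + b + c) / 2)
    (hla : la = 2 / (b + c) * Real.sqrt (b * c * s * (s - a)))
    (hlb : lb = 2 / (a + c) * Real.sqrt (a * c * s * (s - b)))
    (hlc : lc = 2 / (a + b) * Real.sqrt (a * b * s * (s - c))) :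
    b * lb ≥ max (a * la) (c * lc) := by
  subst hla hlb hlc
  refine max_le (side_mul_bisector_le ha hb hc hs hbc hac (shortest_middle_poly_le ha h1 h2)) ?_
  have h := side_mul_bisector_le hc hb ha (s := s) (by linarith) (by linarith) (by linarith)
    (longest_middle_poly_le ha h1 h2)
  rwa [add_comm b a, mul_comm b a, add_comm c a, mul_comm c a] at h
end

section
/- Let a, b, c be the side lengths of a non-degenerate triangle, and let l_a, l_b, l_c be the internal angle bisectors, where l_a = (2/(b + c))·√(b·c·s·(s − a)) with s = (a + b + c)/2, and similarly for l_b and l_c. Then √(bc)·l_a + √(ac)·l_b + √(ab)·l_c ≥ a·l_a + b·l_b + c·l_c. -/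
/-- The square of an angle bisector, with denominators cleared. -/
lemma bisector_sq_mul {a b c s l : ℝ} (ha : 0 < a) (hb : 0 < b) (hc : 0 < c)
    (hbc : a < b + c) (hs : s = (a + b + c) / 2)
    (hl : l = 2 / (b + c) * Real.sqrt (b * c * s * (s - a))) :
    0 ≤ l ∧ l ^ 2 * (b + c) ^ 2 = b * c * (a + b + c) * (b + c - a) := by
  have hs0 : 0 < s := by linarith
  have hsa : 0 < s - a := by linarith
  refine ⟨by rw [hl]; positivity, ?_⟩
  have hsq := Real.sq_sqrt (show 0 ≤ b * c * s * (s - a) by positivity)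
  rw [hl, mul_pow, hsq, hs]
  field_simp
  ring

/-- In a triangle with sides `x²`, `y²`, `c` and `y ≤ x`, the bisectors `l` and `m` to the sides
`x²` and `y²` satisfy `x * l ≤ y * m`. -/
lemma mul_bisector_le {x y c l m : ℝ} (hy : 0 < y) (hc : 0 < c) (hxy : y ≤ x) (hm : 0 ≤ m)
    (hl2 : l ^ 2 * (y ^ 2 + c) ^ 2 = y ^ 2 * c * (x ^ 2 + y ^ 2 + c) * (y ^ 2 + c - x ^ 2))
    (hm2 : m ^ 2 * (x ^ 2 + c) ^ 2 = x ^ 2 * c * (x ^ 2 + y ^ 2 + c) * (x ^ 2 + c - y ^ 2)) :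
    x * l ≤ y * m := by
  have hx : 0 < x := hy.trans_le hxy
  have hd : 0 ≤ x ^ 2 - y ^ 2 := by nlinarith
  have key : (x ^ 2 + c) ^ 2 * (y ^ 2 + c - x ^ 2) ≤ (y ^ 2 + c) ^ 2 * (x ^ 2 + c - y ^ 2) := by
    have h : 0 ≤ (x ^ 2 - y ^ 2) * (2 * y ^ 2 * (y ^ 2 + c) + (x ^ 2 - y ^ 2) * (2 * y ^ 2 + c)
        + (x ^ 2 - y ^ 2) ^ 2) := by positivity
    linarith
  refine (abs_le_of_sq_le_sq' ?_ (by positivity)).2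
  have hq : 0 < (x ^ 2 + c) ^ 2 * (y ^ 2 + c) ^ 2 := by positivity
  refine le_of_mul_le_mul_right ?_ hq
  calc (x * l) ^ 2 * ((x ^ 2 + c) ^ 2 * (y ^ 2 + c) ^ 2)
      = x ^ 2 * (x ^ 2 + c) ^ 2 * (l ^ 2 * (y ^ 2 + c) ^ 2) := by ring
    _ = x ^ 2 * y ^ 2 * c * (x ^ 2 + y ^ 2 + c) * ((x ^ 2 + c) ^ 2 * (y ^ 2 + c - x ^ 2)) := by
        rw [hl2]; ring
    _ ≤ x ^ 2 * y ^ 2 * c * (x ^ 2 + y ^ 2 + c) * ((y ^ 2 + c) ^ 2 * (x ^ 2 + c - y ^ 2)) := by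
        gcongr
    _ = y ^ 2 * (y ^ 2 + c) ^ 2 * (m ^ 2 * (x ^ 2 + c) ^ 2) := by rw [hm2]; ring
    _ = (y * m) ^ 2 * ((x ^ 2 + c) ^ 2 * (y ^ 2 + c) ^ 2) := by ring

/-- The contribution of one pair of sides to the symmetrized inequality. -/
lemma sub_mul_bisector_nonneg {x y z l m : ℝ} (hx : 0 < x) (hy : 0 < y) (hz : 0 < z)
    (hl : 0 ≤ l) (hm : 0 ≤ m)
    (hl2 : l ^ 2 * (y ^ 2 + z ^ 2) ^ 2
      = y ^ 2 * z ^ 2 * (x ^ 2 + y ^ 2 + z ^ 2) * (y ^ 2 + z ^ 2 - x ^ 2))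
    (hm2 : m ^ 2 * (x ^ 2 + z ^ 2) ^ 2
      = x ^ 2 * z ^ 2 * (x ^ 2 + y ^ 2 + z ^ 2) * (x ^ 2 + z ^ 2 - y ^ 2)) :
    0 ≤ (x - y) * ((z + y) * m - (z + x) * l) := by
  rcases le_total y x with h | h
  · have h1 := mul_bisector_le hy (pow_pos hz 2) h hm hl2 hm2
    have hlm : l ≤ m := by
      refine le_of_mul_le_mul_left (h1.trans ?_) hx
      gcongr
    refine mul_nonneg (sub_nonneg.2 h) ?_
    nlinarith
  · have h1 := mul_bisector_le hx (pow_pos hz 2) h hl (l := m) (by linarith) (by linarith)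
    have hlm : m ≤ l := by
      refine le_of_mul_le_mul_left (h1.trans ?_) hy
      gcongr
    refine mul_nonneg_of_nonpos_of_nonpos (sub_nonpos.2 h) ?_
    nlinarith

theorem stmt_14 (a b c s la lb lc : ℝ)
    (ha : 0 < a) (hb : 0 < b) (hc : 0 < c)
    (hab : a + b > c) (hbc : b + c > a) (hac : a + c > b)
    (hs : s = (a + b + c) / 2)
    (hla : la = 2 / (b + c) * Real.sqrt (b * c * s * (s - a)))
    (hlb : lb = 2 / (a + c) * Real.sqrt (a * c * s * (s - b)))
    (hlc : lc = 2 / (a + b) * Real.sqrt (a * b * s * (s - c))) :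
    Real.sqrt (b*c) * la + Real.sqrt (a*c) * lb + Real.sqrt (a*b) * lc
      ≥ a * la + b * lb + c * lc := by
  obtain ⟨hla0, hla2⟩ := bisector_sq_mul ha hb hc hbc hs hla
  obtain ⟨hlb0, hlb2⟩ := bisector_sq_mul hb ha hc hac (by linarith) hlb
  obtain ⟨hlc0, hlc2⟩ := bisector_sq_mul hc ha hb hab (by linarith) hlc
  clear hla hlb hlc hs
  rw [Real.sqrt_mul hb.le, Real.sqrt_mul ha.le, Real.sqrt_mul ha.le]
  have hx := Real.sqrt_pos.2 ha
  have hy := Real.sqrt_pos.2 hb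
  have hz := Real.sqrt_pos.2 hc
  have hxa := Real.sq_sqrt ha.le
  have hyb := Real.sq_sqrt hb.le
  have hzc := Real.sq_sqrt hc.le
  generalize Real.sqrt a = x at *
  generalize Real.sqrt b = y at *
  generalize Real.sqrt c = z at *
  subst hxa hyb hzc
  have h1 := sub_mul_bisector_nonneg hx hy hz hla0 hlb0 (by linarith) (by linarith)
  have h2 := sub_mul_bisector_nonneg hx hz hy hla0 hlc0 (by linarith) (by linarith)
  have h3 := sub_mul_bisector_nonneg hy hz hx hlb0 hlc0 (by linarith) (by linarith)
  linarith
end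

section
/- Let a, b, c be the side lengths of a non-degenerate triangle, and let l_a, l_b, l_c be the internal angle bisectors, where l_a = (2/(b + c))·√(b·c·s·(s − a)) with s = (a + b + c)/2, and similarly for l_b and l_c. Then (bc − a²)·l_a + (ac − b²)·l_b + (ab − c²)·l_c ≥ 0. -/
/-- The bisector opposite `a`, divided by `2 * (b + c)`. -/
noncomputable def scaledBisector (a b c s : ℝ) : ℝ :=
  Real.sqrt (b * c * s * (s - a)) / (b + c) ^ 2

/-- In Ravi coordinates `x = s - a`, `y = s - b`, `z = s - c`. -/
lemma ravi_quartic_le {x y z : ℝ} (hx : 0 < x) (hz : 0 < z) (hxy : x ≤ y) :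
    (x + z) * x * (x + 2 * y + z) ^ 4 ≤ (y + z) * y * (2 * x + y + z) ^ 4 := by
  obtain ⟨t, rfl⟩ := exists_add_of_le hxy
  have ht : 0 ≤ t := by linarith
  rw [← sub_nonneg]
  ring_nf
  positivity

lemma scaledBisector_le {a b c s : ℝ} (hb : 0 < b) (hc : 0 < c)
    (hbc : a < b + c) (hac : c < a + b) (hs : s = (a + b + c) / 2) (hba : b ≤ a) :
    scaledBisector a b c s ≤ scaledBisector b a c s := by
  have ha : 0 < a := hb.trans_le hba
  have hs0 : 0 < s := by linarith
  have h := ravi_quartic_le (x := s - a) (y := s - b) (z := s - c)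
    (by linarith) (by linarith) (by linarith)
  rw [show s - a + (s - c) = b by linarith, show s - b + (s - c) = a by linarith,
    show s - a + 2 * (s - b) + (s - c) = a + c by linarith,
    show 2 * (s - a) + (s - b) + (s - c) = b + c by linarith] at h
  unfold scaledBisector
  rw [div_le_div_iff₀ (by positivity) (by positivity),
    ← Real.sqrt_sq (by positivity : 0 ≤ (a + c) ^ 2),
    ← Real.sqrt_sq (by positivity : 0 ≤ (b + c) ^ 2),
    ← Real.sqrt_mul' _ (by positivity), ← Real.sqrt_mul' _ (by positivity)]
  apply Real.sqrt_le_sqrt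
  linear_combination (c * s) * h

lemma scaledBisector_pair_nonneg {a b c s : ℝ} (ha : 0 < a) (hb : 0 < b) (hc : 0 < c)
    (hab : c < a + b) (hbc : a < b + c) (hac : b < a + c) (hs : s = (a + b + c) / 2) :
    0 ≤ ((b * c - a ^ 2) * (b + c) - (a * c - b ^ 2) * (a + c)) *
      (scaledBisector a b c s - scaledBisector b a c s) := by
  rw [show (b * c - a ^ 2) * (b + c) - (a * c - b ^ 2) * (a + c) =
    (b - a) * (2 * c * (a + b) + c ^ 2 + a * b) by ring]
  rcases le_total b a with h | h
  · exact mul_nonneg_of_nonpos_of_nonpos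
      (mul_nonpos_of_nonpos_of_nonneg (by linarith) (by positivity))
      (sub_nonpos.2 (scaledBisector_le hb hc hbc hab hs h))
  · exact mul_nonneg (mul_nonneg (by linarith) (by positivity))
      (sub_nonneg.2 (scaledBisector_le ha hc hac (by linarith) (by linarith) h))

lemma bisector_eq_scaledBisector {a b c s : ℝ} (hb : 0 < b) (hc : 0 < c) :
    2 / (b + c) * Real.sqrt (b * c * s * (s - a)) =
      2 * (b + c) * scaledBisector a b c s := by
  unfold scaledBisector
  field_simp

lemma scaledBisector_comm (a b c s : ℝ) :
    scaledBisector a b c s = scaledBisector a c b s := by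
  unfold scaledBisector
  rw [mul_comm b c, add_comm b c]

theorem stmt_15 (a b c s la lb lc : ℝ)
    (ha : 0 < a) (hb : 0 < b) (hc : 0 < c)
    (hab : a + b > c) (hbc : b + c > a) (hac : a + c > b)
    (hs : s = (a + b + c) / 2)
    (hla : la = 2 / (b + c) * Real.sqrt (b * c * s * (s - a)))
    (hlb : lb = 2 / (a + c) * Real.sqrt (a * c * s * (s - b)))
    (hlc : lc = 2 / (a + b) * Real.sqrt (a * b * s * (s - c))) :
    (b*c - a^2) * la + (a*c - b^2) * lb + (a*b - c^2) * lc ≥ 0 := by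
  rw [bisector_eq_scaledBisector hb hc] at hla
  rw [bisector_eq_scaledBisector ha hc] at hlb
  rw [bisector_eq_scaledBisector ha hb] at hlc
  have h₁ := scaledBisector_pair_nonneg ha hb hc hab hbc hac hs
  have h₂ := scaledBisector_pair_nonneg (s := s) ha hc hb hac
    (by linarith) hab (by linarith)
  have h₃ := scaledBisector_pair_nonneg (s := s) hb hc ha hbc
    (by linarith) (by linarith) (by linarith)
  rw [scaledBisector_comm a c b] at h₂
  rw [scaledBisector_comm b c a, scaledBisector_comm c b a] at h₃
  subst hla hlb hlc
  linear_combination (2 / 3) * (h₁ + h₂ + h₃)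
end

section
/- Let a, b, c be the side lengths of a non-degenerate triangle with a ≤ b ≤ c, and let l_a, l_c be the internal angle bisectors from the vertices opposite sides a and c respectively. Then √c·l_c ≤ √a·l_a. -/
/-- The squared form of the comparison of the two angle bisectors, cleared of common factors. -/
theorem sub_mul_sq_le_sub_mul_sq {a b c : ℝ} (ha : 0 < a) (hb : 0 < b) (hc : 0 < c)
    (hac : a ≤ c) : (a + b - c) * (b + c) ^ 2 ≤ (b + c - a) * (a + b) ^ 2 := by
  have h : 0 ≤ (c - a) * (a ^ 2 + a * b + b * c + c ^ 2) :=
    mul_nonneg (sub_nonneg.2 hac) (by positivity)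
  linarith

theorem stmt_16 (a b c s la lc : ℝ)
    (ha : 0 < a) (hb : 0 < b) (hc : 0 < c)
    (hab : a + b > c) (hbc : b + c > a) (hac : a + c > b)
    (h1 : a ≤ b) (h2 : b ≤ c)
    (hs : s = (a + b + c) / 2)
    (hla : la = 2 / (b + c) * Real.sqrt (b * c * s * (s - a)))
    (hlc : lc = 2 / (a + b) * Real.sqrt (a * b * s * (s - c))) :
    Real.sqrt c * lc ≤ Real.sqrt a * la := by
  have hs0 : 0 < s := by linarith
  have hsa : 0 ≤ s - a := by linarith
  have hsc : 0 ≤ s - c := by linarith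
  have key : (s - c) * (b + c) ^ 2 ≤ (s - a) * (a + b) ^ 2 := by
    have := sub_mul_sq_le_sub_mul_sq ha hb hc (h1.trans h2)
    rw [hs]
    linarith
  have hdiv : (s - c) / (a + b) ^ 2 ≤ (s - a) / (b + c) ^ 2 := by
    rwa [div_le_div_iff₀ (by positivity) (by positivity)]
  have hla0 : 0 ≤ la := by rw [hla]; positivity
  refine le_of_pow_le_pow_left₀ two_ne_zero (by positivity) ?_
  rw [mul_pow, mul_pow, hla, hlc, mul_pow, mul_pow, Real.sq_sqrt hc.le, Real.sq_sqrt ha.le,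
    Real.sq_sqrt (by positivity), Real.sq_sqrt (by positivity)]
  calc c * ((2 / (a + b)) ^ 2 * (a * b * s * (s - c)))
      = 4 * a * b * c * s * ((s - c) / (a + b) ^ 2) := by rw [div_pow]; ring
    _ ≤ 4 * a * b * c * s * ((s - a) / (b + c) ^ 2) := by gcongr
    _ = a * ((2 / (b + c)) ^ 2 * (b * c * s * (s - a))) := by rw [div_pow]; ring
end

section
/- Let a, b, c be the side lengths of a non-degenerate triangle with a ≤ b ≤ c, and let l_a, l_b be the internal angle bisectors from the vertices opposite sides a and b respectively. Then l_a / l_b ≥ (b + c − a)/c. -/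
theorem mul_sq_mul_sq_sub_sq_le {a b c : ℝ} (ha : 0 < a) (h1 : a ≤ b) (h2 : b ≤ c) :
    a * (b + c) ^ 2 * (c ^ 2 - (b - a) ^ 2) ≤ c ^ 2 * b * (a + c) ^ 2 := by
  have hprod : a * b ≤ c ^ 2 := by nlinarith
  have hcmp : a * (b + c) ^ 2 ≤ b * (a + c) ^ 2 := by
    nlinarith [mul_nonneg (sub_nonneg.2 h1) (sub_nonneg.2 hprod)]
  calc a * (b + c) ^ 2 * (c ^ 2 - (b - a) ^ 2)
      ≤ a * (b + c) ^ 2 * c ^ 2 := by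
        gcongr
        linarith [sq_nonneg (b - a)]
    _ ≤ b * (a + c) ^ 2 * c ^ 2 := by gcongr
    _ = c ^ 2 * b * (a + c) ^ 2 := by ring


theorem stmt_17 (a b c s la lb : ℝ)
    (ha : 0 < a) (hb : 0 < b) (hc : 0 < c)
    (hab : a + b > c) (hbc : b + c > a) (hac : a + c > b)
    (h1 : a ≤ b) (h2 : b ≤ c)
    (hs : s = (a + b + c) / 2)
    (hla : la = 2 / (b + c) * Real.sqrt (b * c * s * (s - a)))
    (hlb : lb = 2 / (a + c) * Real.sqrt (a * c * s * (s - b))) :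
    la / lb ≥ (b + c - a) / c := by
  have hsa : 0 < s - a := by linarith
  have hsb : 0 < s - b := by linarith
  have hs0 : 0 < s := by linarith
  have hla0 : 0 < la := by rw [hla]; positivity
  have hlb0 : 0 < lb := by rw [hlb]; positivity
  have hla2 : la ^ 2 = (4 * (b * c * s * (s - a))) / (b + c) ^ 2 := by
    rw [hla, mul_pow, div_pow, Real.sq_sqrt (by positivity)]
    ring
  have hlb2 : lb ^ 2 = (4 * (a * c * s * (s - b))) / (a + c) ^ 2 := by
    rw [hlb, mul_pow, div_pow, Real.sq_sqrt (by positivity)]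
    ring
  rw [ge_iff_le, div_le_div_iff₀ hc hlb0]
  refine (sq_le_sq₀ (mul_nonneg (by linarith) hlb0.le) (by positivity)).1 ?_
  rw [mul_pow, mul_pow, hla2, hlb2, mul_div_assoc', div_mul_eq_mul_div,
    div_le_div_iff₀ (by positivity) (by positivity)]
  have key := mul_le_mul_of_nonneg_left (mul_sq_mul_sq_sub_sq_le ha h1 h2)
    (by positivity : 0 ≤ 4 * c * s * (s - a))
  subst hs
  linear_combination key
end

section
/- Let a, b, c be the side lengths of a non-degenerate triangle with a ≤ b ≤ c, and let l_a, l_b, l_c be the internal angle bisectors. Then bc·l_a + ac·l_b ≥ c²·l_c + b²·l_b. -/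
/-- The square of the internal angle bisector of length `2 / (y + z) * √(y z s (s - x))`. -/
lemma bisector_sq {x y z s l : ℝ} (hy : 0 < y) (hz : 0 < z) (hx : 0 < x) (h : x < y + z)
    (hs : s = (x + y + z) / 2) (hl : l = 2 / (y + z) * Real.sqrt (y * z * s * (s - x))) :
    l ^ 2 = y * z * (x + y + z) * (y + z - x) / (y + z) ^ 2 := by
  have hs0 : 0 < s := by linarith
  have hsx : 0 < s - x := by linarith
  rw [hl, mul_pow, Real.sq_sqrt (by positivity), hs]
  field_simp
  ring

/-- The polynomial inequality behind `b * l_a ≥ c * l_c`. -/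
lemma bisector_poly_side {a b c : ℝ} (h1 : a ≤ b) (h2 : b ≤ c) (hab : c < a + b) :
    c * a * (a + b - c) * (b + c) ^ 2 ≤ b ^ 2 * (b + c - a) * (a + b) ^ 2 := by
  obtain ⟨u, rfl⟩ : ∃ u, b = a + u := ⟨b - a, by ring⟩
  obtain ⟨v, rfl⟩ : ∃ v, c = a + u + v := ⟨c - (a + u), by ring⟩
  obtain ⟨w, rfl⟩ : ∃ w, a = v + w := ⟨a - v, by ring⟩
  have hu : 0 ≤ u := by linarith
  have hv : 0 ≤ v := by linarith
  have hw : 0 ≤ w := by linarith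
  rw [← sub_nonneg]
  ring_nf
  positivity

/-- The polynomial inequality left after applying Cauchy-Schwarz to
`c ^ 2 * l_c + (b ^ 2 - a * c) * l_b`. -/
lemma bisector_poly_cauchy {a b c : ℝ} (h1 : a ≤ b) (h2 : b ≤ c) (hab : c < a + b) :
    (c ^ 2 + b ^ 2 - a * c) * (c * a * b * (a + b - c) * (b + c) ^ 2 * (a + c) ^ 2
      + (b ^ 2 - a * c) * a * (a + c - b) * (b + c) ^ 2 * (a + b) ^ 2)
    ≤ b ^ 3 * c ^ 2 * (b + c - a) * (a + c) ^ 2 * (a + b) ^ 2 := by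
  obtain ⟨u, rfl⟩ : ∃ u, b = a + u := ⟨b - a, by ring⟩
  obtain ⟨v, rfl⟩ : ∃ v, c = a + u + v := ⟨c - (a + u), by ring⟩
  obtain ⟨w, rfl⟩ : ∃ w, a = v + w := ⟨a - v, by ring⟩
  have hu : 0 ≤ u := by linarith
  have hv : 0 ≤ v := by linarith
  have hw : 0 ≤ w := by linarith
  rw [← sub_nonneg]
  ring_nf
  positivity

theorem stmt_18 (a b c s la lb lc : ℝ)
    (ha : 0 < a) (hb : 0 < b) (hc : 0 < c)
    (hab : a + b > c) (hbc : b + c > a) (hac : a + c > b)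
    (h1 : a ≤ b) (h2 : b ≤ c)
    (hs : s = (a + b + c) / 2)
    (hla : la = 2 / (b + c) * Real.sqrt (b * c * s * (s - a)))
    (hlb : lb = 2 / (a + c) * Real.sqrt (a * c * s * (s - b)))
    (hlc : lc = 2 / (a + b) * Real.sqrt (a * b * s * (s - c))) :
    b * c * la + a * c * lb ≥ c^2 * lc + b^2 * lb := by
  have la0 : 0 ≤ la := by rw [hla]; positivity
  have lb0 : 0 ≤ lb := by rw [hlb]; positivity
  have qa := bisector_sq hb hc ha hbc hs hla
  have qb := bisector_sq ha hc hb hac (by rw [hs]; ring) hlb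
  have qc := bisector_sq ha hb hc hab (by rw [hs]; ring) hlc
  rcases le_total (b ^ 2) (a * c) with h | h
  · have hside : c * lc ≤ b * la := by
      refine le_of_sq_le_sq ?_ (by positivity)
      have key := mul_nonneg (by positivity : 0 ≤ b * c * (a + b + c))
        (sub_nonneg.2 (bisector_poly_side h1 h2 hab))
      rw [mul_pow, mul_pow, qa, qc, ← sub_nonneg]
      have e : b ^ 2 * (b * c * (a + b + c) * (b + c - a) / (b + c) ^ 2)
          - c ^ 2 * (a * b * (c + a + b) * (a + b - c) / (a + b) ^ 2)
          = b * c * (a + b + c) * (b ^ 2 * (b + c - a) * (a + b) ^ 2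
            - c * a * (a + b - c) * (b + c) ^ 2) / ((a + b) ^ 2 * (b + c) ^ 2) := by
        field_simp
        ring
      rw [e]
      positivity
    nlinarith [mul_le_mul_of_nonneg_left hside hc.le, mul_nonneg (sub_nonneg.2 h) lb0]
  · have hq : 0 ≤ b ^ 2 - a * c := sub_nonneg.2 h
    have hcauchy : (c ^ 2 * lc + (b ^ 2 - a * c) * lb) ^ 2
        ≤ (c ^ 2 + b ^ 2 - a * c) * (c ^ 2 * lc ^ 2 + (b ^ 2 - a * c) * lb ^ 2) := by
      have := mul_nonneg (mul_nonneg (sq_nonneg c) hq) (sq_nonneg (lc - lb))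
      linear_combination this
    have hpoly : (c ^ 2 + b ^ 2 - a * c) * (c ^ 2 * lc ^ 2 + (b ^ 2 - a * c) * lb ^ 2)
        ≤ (b * c * la) ^ 2 := by
      have key := mul_nonneg (by positivity : 0 ≤ c * (a + b + c))
        (sub_nonneg.2 (bisector_poly_cauchy h1 h2 hab))
      rw [mul_pow, qa, qb, qc, ← sub_nonneg]
      have e : (b * c) ^ 2 * (b * c * (a + b + c) * (b + c - a) / (b + c) ^ 2)
          - (c ^ 2 + b ^ 2 - a * c) * (c ^ 2 * (a * b * (c + a + b) * (a + b - c) / (a + b) ^ 2)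
            + (b ^ 2 - a * c) * (a * c * (b + a + c) * (a + c - b) / (a + c) ^ 2))
          = c * (a + b + c) * (b ^ 3 * c ^ 2 * (b + c - a) * (a + c) ^ 2 * (a + b) ^ 2
            - (c ^ 2 + b ^ 2 - a * c) * (c * a * b * (a + b - c) * (b + c) ^ 2 * (a + c) ^ 2
              + (b ^ 2 - a * c) * a * (a + c - b) * (b + c) ^ 2 * (a + b) ^ 2))
            / ((a + b) ^ 2 * (b + c) ^ 2 * (a + c) ^ 2) := by
        field_simp
        ring
      rw [e]
      positivity
    have := le_of_sq_le_sq (hcauchy.trans hpoly) (by positivity)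
    linarith
end

section
/- Let a, b, c be the side lengths of a non-degenerate triangle with medians m_a, m_b, m_c, altitudes h_a, h_b, h_c, and internal angle bisectors l_a, l_b, l_c. For any nonnegative reals α, β, γ, define f_a = α·m_a + β·h_a + γ·l_a, f_b = α·m_b + β·h_b + γ·l_b, f_c = α·m_c + β·h_c + γ·l_c. Then (√(bc) − a)·f_a + (√(ac) − b)·f_b + (√(ab) − c)·f_c ≥ 0 and (bc − a²)·f_a + (ac − b²)·f_b + (ab − c²)·f_c ≥ 0. -/
/-- A nonnegative combination of the median, the altitude and the internal angle bisector to the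
side `x` in a triangle with sides `x`, `y`, `z` and area `S`. -/
noncomputable def cevianCombo (α β γ S x y z : ℝ) : ℝ :=
  α * (Real.sqrt (2 * y ^ 2 + 2 * z ^ 2 - x ^ 2) / 2) + β * (2 * S / x) +
    γ * (2 / (y + z) * Real.sqrt (y * z * ((x + y + z) / 2) * ((x + y + z) / 2 - x)))

theorem cevianCombo_swap (α β γ S x y z : ℝ) :
    cevianCombo α β γ S x y z = cevianCombo α β γ S x z y := by
  unfold cevianCombo
  ring_nf

theorem cevianCombo_nonneg {α β γ S x y z : ℝ} (hα : 0 ≤ α) (hβ : 0 ≤ β) (hγ : 0 ≤ γ)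
    (hS : 0 ≤ S) (hx : 0 < x) (hy : 0 < y) (hz : 0 < z) :
    0 ≤ cevianCombo α β γ S x y z := by
  unfold cevianCombo
  positivity

theorem mul_sqrt_le_mul_sqrt {p q u v : ℝ} (hp : 0 ≤ p) (hq : 0 ≤ q)
    (h : p ^ 2 * u ≤ q ^ 2 * v) : p * Real.sqrt u ≤ q * Real.sqrt v := by
  have := Real.sqrt_le_sqrt h
  rwa [Real.sqrt_mul (sq_nonneg p), Real.sqrt_mul (sq_nonneg q), Real.sqrt_sq hp,
    Real.sqrt_sq hq] at this

theorem add_mul_median_le {x y z : ℝ} (hx : 0 < x) (hy : 0 < y) (hz : 0 < z) (hxy : y ≤ x)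
    (hzxy : z < x + y) :
    (x + z) * Real.sqrt (2 * y ^ 2 + 2 * z ^ 2 - x ^ 2) ≤
      (y + z) * Real.sqrt (2 * x ^ 2 + 2 * z ^ 2 - y ^ 2) := by
  refine mul_sqrt_le_mul_sqrt (by positivity) (by positivity) ?_
  have hw : 0 ≤ x + y - z := by linarith
  have key : 0 ≤ (x - y) * ((x + y - z) * ((x + y) ^ 2 / 2 + 3 * (x + y) * z + 4 * z ^ 2
      + (x - y) ^ 2 / 2)) := mul_nonneg (by linarith) (by positivity)
  linear_combination key

theorem add_mul_bisector_le {x y z : ℝ} (hy : 0 < y) (hz : 0 < z) (hxy : y ≤ x)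
    (hxyz : x < y + z) :
    (x + z) * (2 / (y + z) * Real.sqrt (y * z * ((x + y + z) / 2) * ((x + y + z) / 2 - x))) ≤
      (y + z) * (2 / (x + z) * Real.sqrt (x * z * ((y + x + z) / 2) * ((y + x + z) / 2 - y))) := by
  have hx : 0 < x := by linarith
  have key : 0 ≤ x * (x + z - y) * (y + z) ^ 4 - y * (y + z - x) * (x + z) ^ 4 := by
    obtain ⟨t, rfl⟩ : ∃ t, x = y + t := ⟨x - y, by ring⟩
    obtain ⟨w, rfl⟩ : ∃ w, z = t + w := ⟨z - t, by ring⟩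
    have ht : 0 ≤ t := by linarith
    have hw : 0 ≤ w := by linarith
    ring_nf
    positivity
  have hyz : 0 < y + z := by linarith
  have hxz : 0 < x + z := by linarith
  rw [← mul_assoc, ← mul_assoc]
  refine mul_sqrt_le_mul_sqrt (by positivity) (by positivity) ?_
  rw [← sub_nonneg]
  have : ((y + z) * (2 / (x + z))) ^ 2 * (x * z * ((y + x + z) / 2) * ((y + x + z) / 2 - y)) -
      ((x + z) * (2 / (y + z))) ^ 2 * (y * z * ((x + y + z) / 2) * ((x + y + z) / 2 - x)) =
      z * (x + y + z) * (x * (x + z - y) * (y + z) ^ 4 - y * (y + z - x) * (x + z) ^ 4) /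
        ((x + z) ^ 2 * (y + z) ^ 2) := by
    field_simp
    ring
  rw [this]
  positivity

theorem add_mul_cevianCombo_le {α β γ S x y z : ℝ} (hα : 0 ≤ α) (hβ : 0 ≤ β) (hγ : 0 ≤ γ)
    (hS : 0 ≤ S) (hy : 0 < y) (hz : 0 < z) (hxy : y ≤ x) (hxyz : x < y + z) (hzxy : z < x + y) :
    (x + z) * cevianCombo α β γ S x y z ≤ (y + z) * cevianCombo α β γ S y x z := by
  have hx : 0 < x := by linarith
  have hm := mul_le_mul_of_nonneg_left (add_mul_median_le hx hy hz hxy hzxy) hα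
  have hb := mul_le_mul_of_nonneg_left (add_mul_bisector_le hy hz hxy hxyz) hγ
  have hh : (x + z) * (2 * S / x) ≤ (y + z) * (2 * S / y) := by
    have : (y + z) * (2 * S / y) - (x + z) * (2 * S / x) = 2 * S * z * (x - y) / (x * y) := by
      field_simp
      ring
    have : 0 ≤ 2 * S * z * (x - y) / (x * y) :=
      div_nonneg (mul_nonneg (by positivity) (by linarith)) (by positivity)
    linarith
  have hh := mul_le_mul_of_nonneg_left hh hβ
  unfold cevianCombo
  linarith

theorem sub_mul_cevianCombo_nonneg {α β γ S x y z : ℝ} (hα : 0 ≤ α) (hβ : 0 ≤ β) (hγ : 0 ≤ γ)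
    (hS : 0 ≤ S) (hx : 0 < x) (hy : 0 < y) (hz : 0 < z)
    (hxyz : x < y + z) (hyxz : y < x + z) (hzxy : z < x + y) :
    0 ≤ (x - y) * ((y + z) * cevianCombo α β γ S y x z - (x + z) * cevianCombo α β γ S x y z) := by
  rcases le_total y x with h | h
  · have := add_mul_cevianCombo_le hα hβ hγ hS hy hz h hxyz hzxy
    exact mul_nonneg (by linarith) (by linarith)
  · have := add_mul_cevianCombo_le hα hβ hγ hS hx hz h hyxz (by linarith)
    exact mul_nonneg_of_nonpos_of_nonpos (by linarith) (by linarith)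

/-- An inequality between values weighted by sums of squares descends to the weights themselves. -/
theorem add_mul_le_of_sq_add_mul_le {u v w f g : ℝ} (hv : 0 < v) (hw : 0 < w)
    (huv : v ≤ u) (hwuv : w ^ 2 ≤ u ^ 2 + v ^ 2) (hf : 0 ≤ f)
    (h : (u ^ 2 + w ^ 2) * f ≤ (v ^ 2 + w ^ 2) * g) : (u + w) * f ≤ (v + w) * g := by
  have hu : 0 < u := by linarith
  have hlt : w ≤ u + v := by nlinarith [mul_pos hu hv]
  have hq : 0 ≤ u * v + w * (u + v) - w ^ 2 := by
    nlinarith [mul_pos hu hv, mul_nonneg hw.le (sub_nonneg.2 hlt)]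
  have hweights : (u + w) * (v ^ 2 + w ^ 2) ≤ (u ^ 2 + w ^ 2) * (v + w) := by
    linear_combination mul_nonneg (sub_nonneg.2 huv) hq
  refine le_of_mul_le_mul_left ?_ (show 0 < v ^ 2 + w ^ 2 by positivity)
  have h₁ := mul_le_mul_of_nonneg_right hweights hf
  have h₂ := mul_le_mul_of_nonneg_right h (show 0 ≤ v + w by positivity)
  linarith

theorem sub_mul_nonneg_of_sq {u v w f g : ℝ} (hu : 0 < u) (hv : 0 < v) (hw : 0 < w)
    (hwuv : w ^ 2 ≤ u ^ 2 + v ^ 2) (hf : 0 ≤ f) (hg : 0 ≤ g)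
    (h : 0 ≤ (u ^ 2 - v ^ 2) * ((v ^ 2 + w ^ 2) * g - (u ^ 2 + w ^ 2) * f)) :
    0 ≤ (u - v) * ((v + w) * g - (u + w) * f) := by
  rcases lt_trichotomy u v with huv | rfl | huv
  · have hsq : u ^ 2 - v ^ 2 < 0 := by nlinarith
    have := add_mul_le_of_sq_add_mul_le hu hw huv.le (by linarith) hg
      (sub_nonpos.1 (nonpos_of_mul_nonneg_right h hsq))
    exact mul_nonneg_of_nonpos_of_nonpos (by linarith) (by linarith)
  · simp
  · have hsq : 0 < u ^ 2 - v ^ 2 := by nlinarith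
    have := add_mul_le_of_sq_add_mul_le hv hw huv.le hwuv hf
      (sub_nonneg.1 (nonneg_of_mul_nonneg_right h hsq))
    exact mul_nonneg (by linarith) (by linarith)

/-- A sum-of-squares type criterion. -/
theorem sum_mul_sub_sq_nonneg {x y z f g h : ℝ}
    (hxy : 0 ≤ (x - y) * ((y + z) * g - (x + z) * f))
    (hxz : 0 ≤ (x - z) * ((z + y) * h - (x + y) * f))
    (hyz : 0 ≤ (y - z) * ((z + x) * h - (y + x) * g)) :
    0 ≤ (y * z - x ^ 2) * f + (x * z - y ^ 2) * g + (x * y - z ^ 2) * h := by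
  linear_combination (hxy + hxz + hyz) / 2

theorem stmt_19 (a b c s S ma mb mc ha' hb' hc' la lb lc α β γ fa fb fc : ℝ)
    (ha : 0 < a) (hb : 0 < b) (hc : 0 < c)
    (hab : a + b > c) (hbc : b + c > a) (hac : a + c > b)
    (hs : s = (a + b + c) / 2)
    (hS : S = Real.sqrt (s * (s - a) * (s - b) * (s - c)))
    (hma : ma = Real.sqrt (2*b^2 + 2*c^2 - a^2) / 2)
    (hmb : mb = Real.sqrt (2*a^2 + 2*c^2 - b^2) / 2)
    (hmc : mc = Real.sqrt (2*a^2 + 2*b^2 - c^2) / 2)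
    (hha : ha' = 2 * S / a) (hhb : hb' = 2 * S / b) (hhc : hc' = 2 * S / c)
    (hla : la = 2 / (b + c) * Real.sqrt (b * c * s * (s - a)))
    (hlb : lb = 2 / (a + c) * Real.sqrt (a * c * s * (s - b)))
    (hlc : lc = 2 / (a + b) * Real.sqrt (a * b * s * (s - c)))
    (hα : 0 ≤ α) (hβ : 0 ≤ β) (hγ : 0 ≤ γ)
    (hfa : fa = α * ma + β * ha' + γ * la)
    (hfb : fb = α * mb + β * hb' + γ * lb)
    (hfc : fc = α * mc + β * hc' + γ * lc) :
    (Real.sqrt (b*c) - a) * fa + (Real.sqrt (a*c) - b) * fb + (Real.sqrt (a*b) - c) * fc ≥ 0 ∧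
    (b*c - a^2) * fa + (a*c - b^2) * fb + (a*b - c^2) * fc ≥ 0 := by
  have hS0 : 0 ≤ S := hS ▸ Real.sqrt_nonneg _
  have efa : fa = cevianCombo α β γ S a b c := by
    rw [hfa, hma, hha, hla, hs, cevianCombo]
  have efb : fb = cevianCombo α β γ S b a c := by
    rw [hfb, hmb, hhb, hlb, hs, cevianCombo, add_comm b a]
  have efc : fc = cevianCombo α β γ S c a b := by
    rw [hfc, hmc, hhc, hlc, hs, cevianCombo, show c + a + b = a + b + c by ring]
  have h_ab := sub_mul_cevianCombo_nonneg hα hβ hγ hS0 ha hb hc hbc hac hab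
  have h_ac := sub_mul_cevianCombo_nonneg hα hβ hγ hS0 ha hc hb (by linarith) hab hac
  have h_bc := sub_mul_cevianCombo_nonneg hα hβ hγ hS0 hb hc ha (by linarith) (by linarith) hbc
  rw [cevianCombo_swap α β γ S a c b, ← efa, ← efc] at h_ac
  rw [cevianCombo_swap α β γ S c b a, cevianCombo_swap α β γ S b c a, ← efb, ← efc] at h_bc
  rw [← efa, ← efb] at h_ab
  refine ⟨?_, sum_mul_sub_sq_nonneg h_ab h_ac h_bc⟩
  have hfa0 : 0 ≤ fa := efa ▸ cevianCombo_nonneg hα hβ hγ hS0 ha hb hc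
  have hfb0 : 0 ≤ fb := efb ▸ cevianCombo_nonneg hα hβ hγ hS0 hb ha hc
  have hfc0 : 0 ≤ fc := efc ▸ cevianCombo_nonneg hα hβ hγ hS0 hc ha hb
  have hx := Real.sqrt_pos.2 ha
  have hy := Real.sqrt_pos.2 hb
  have hz := Real.sqrt_pos.2 hc
  have hxa := Real.sq_sqrt ha.le
  have hyb := Real.sq_sqrt hb.le
  have hzc := Real.sq_sqrt hc.le
  have k := sum_mul_sub_sq_nonneg
    (sub_mul_nonneg_of_sq hx hy hz (by linarith) hfa0 hfb0 (by rwa [hxa, hyb, hzc]))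
    (sub_mul_nonneg_of_sq hx hz hy (by linarith) hfa0 hfc0 (by rwa [hxa, hyb, hzc]))
    (sub_mul_nonneg_of_sq hy hz hx (by linarith) hfb0 hfc0 (by rwa [hxa, hyb, hzc]))
  rwa [hxa, hyb, hzc, ← Real.sqrt_mul hb.le, ← Real.sqrt_mul ha.le, ← Real.sqrt_mul ha.le] at k
end
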